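/- arXiv:0902.2099 — 5 statements merged into one kernel-verified Lean document; each statement's English description precedes it below -/
import Mathlib

section
/- Let i, j be integers. In the field ℚ(q, t, u_1, u_2) of rational functions, set v_1 = q^i u_1 and v_2 = q^j u_2, and let A be the 2×2 matrix with entries A_{kl} = v_k^{2-l} · (1 - t^{l-1} · (1-tv_k)/(1-v_k) · (v_k-u_1)/(v_k-tu_1) · (v_k-u_2)/(v_k-tu_2)) for 1 ≤ k, l ≤ 2. Then det(A)/(q^i u_1 - q^j u_2) = (t-1)²/((t-q^i)(t-q^j)) · [ (1-q^{2i}u_1)/(1-q^i u_1) · (1-q^{2j}u_2)/(1-q^j u_2) · (1 + t^{-1} · (1-q^i)/(1-q^i u_1/(t u_2)) · (1-q^j)/(1-q^j u_2/(t u_1))) - (q^i u_1 + q^j u_2) · (1-q^i)/(1-q^i u_1) · (1-q^j)/(1-q^j u_2) · (1-q^i/t)/(1-q^i u_1/(t u_2)) · (1-q^j/t)/(1-q^j u_2/(t u_1)) ]. -/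
open Finset

noncomputable abbrev K2 : Type := FractionRing (MvPolynomial (Fin 4) ℚ)

noncomputable def q2 : K2 := algebraMap (MvPolynomial (Fin 4) ℚ) K2 (MvPolynomial.X 0)
noncomputable def t2 : K2 := algebraMap (MvPolynomial (Fin 4) ℚ) K2 (MvPolynomial.X 1)
noncomputable def u2₁ : K2 := algebraMap (MvPolynomial (Fin 4) ℚ) K2 (MvPolynomial.X 2)
noncomputable def u2₂ : K2 := algebraMap (MvPolynomial (Fin 4) ℚ) K2 (MvPolynomial.X 3)

/-- The entry `A_{kl}` (with `1 ≤ k, l ≤ 2`) of the matrix `A`, where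
`v` is the pair `(v_1, v_2)`. -/
noncomputable def Aent (q t u₁ u₂ : K2) (v : Fin 2 → K2) (k l : Fin 2) : K2 :=
  v k ^ (2 - ((l : ℕ) + 1)) *
    (1 - t ^ (l : ℕ) * ((1 - t * v k) / (1 - v k)) *
      ((v k - u₁) / (v k - t * u₁)) * ((v k - u₂) / (v k - t * u₂)))

/-- If `q ^ n * p = r` for polynomials `p` and `r`, then `p` and `r` agree at every point whose
`q`-coordinate is `1`. -/
lemma eval_eq_of_q2_zpow_mul_eq (n : ℤ) (p r : MvPolynomial (Fin 4) ℚ) (x : Fin 4 → ℚ)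
    (hx : x 0 = 1)
    (h : q2 ^ n * algebraMap (MvPolynomial (Fin 4) ℚ) K2 p = algebraMap _ K2 r) :
    MvPolynomial.eval x p = MvPolynomial.eval x r := by
  have inj := IsFractionRing.injective (MvPolynomial (Fin 4) ℚ) K2
  have hq : q2 ≠ 0 := (map_ne_zero_iff _ inj).2 (MvPolynomial.X_ne_zero 0)
  obtain ⟨m, rfl | rfl⟩ := n.eq_nat_or_neg
  · have h' : MvPolynomial.X 0 ^ m * p = r := by
      apply inj
      simpa [q2] using h
    simpa [hx] using congrArg (MvPolynomial.eval x) h'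
  · have h' : p = MvPolynomial.X 0 ^ m * r := by
      apply inj
      rw [zpow_neg, zpow_natCast, inv_mul_eq_iff_eq_mul₀ (pow_ne_zero _ hq)] at h
      simpa [q2] using h
    simpa [hx] using congrArg (MvPolynomial.eval x) h'

lemma q2_zpow_mul_ne (n : ℤ) (p r : MvPolynomial (Fin 4) ℚ)
    (h : MvPolynomial.eval ![1, 2, 3, 5] p ≠ MvPolynomial.eval ![1, 2, 3, 5] r) :
    q2 ^ n * algebraMap (MvPolynomial (Fin 4) ℚ) K2 p ≠ algebraMap _ K2 r :=
  fun e => h (eval_eq_of_q2_zpow_mul_eq n p r _ rfl e)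

set_option maxRecDepth 10000 in
lemma det_Aent_div_eq (q t u w a b : K2) (ht : t ≠ 0) (hu : u ≠ 0) (hw : w ≠ 0)
    (hab : a * u - b * w ≠ 0) (hta : t - a ≠ 0) (htb : t - b ≠ 0)
    (hau : 1 - a * u ≠ 0) (hbw : 1 - b * w ≠ 0)
    (haw : t * w - a * u ≠ 0) (hbu : t * u - b * w ≠ 0) :
    Matrix.det (Matrix.of (Aent q t u w ![a * u, b * w])) / (a * u - b * w) =
      (t - 1) ^ 2 / ((t - a) * (t - b)) *
        (((1 - a ^ 2 * u) / (1 - a * u)) * ((1 - b ^ 2 * w) / (1 - b * w)) *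
            (1 + t⁻¹ * ((1 - a) / (1 - a * u / (t * w))) *
              ((1 - b) / (1 - b * w / (t * u))))
          - (a * u + b * w) * ((1 - a) / (1 - a * u)) * ((1 - b) / (1 - b * w)) *
              ((1 - a / t) / (1 - a * u / (t * w))) *
              ((1 - b / t) / (1 - b * w / (t * u)))) := by
  have e₁ : (a * u - u) / (a * u - t * u) = (1 - a) / (t - a) := by
    rw [div_eq_div_iff _ hta]
    · ring
    · rw [← sub_mul]
      exact mul_ne_zero (by rwa [← neg_sub, neg_ne_zero]) hu
  have e₂ : (b * w - w) / (b * w - t * w) = (1 - b) / (t - b) := by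
    rw [div_eq_div_iff _ htb]
    · ring
    · rw [← sub_mul]
      exact mul_ne_zero (by rwa [← neg_sub, neg_ne_zero]) hw
  have e₃ : (a * u - w) / (a * u - t * w) = (w - a * u) / (t * w - a * u) := by
    rw [← neg_sub w, ← neg_sub (t * w), neg_div_neg_eq]
  have e₄ : (b * w - u) / (b * w - t * u) = (u - b * w) / (t * u - b * w) := by
    rw [← neg_sub u, ← neg_sub (t * u), neg_div_neg_eq]
  have e₅ : 1 - a * u / (t * w) = (t * w - a * u) / (t * w) := by field_simp
  have e₆ : 1 - b * w / (t * u) = (t * u - b * w) / (t * u) := by field_simp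
  rw [Matrix.det_fin_two]
  simp only [Matrix.of_apply, Aent, Matrix.cons_val_zero, Matrix.cons_val_one, Fin.val_zero,
    Fin.val_one, zero_add, pow_zero, pow_one, one_mul, Nat.reduceAdd, Nat.reduceSub]
  rw [e₁, e₂, e₃, e₄, e₅, e₆]
  rw [mul_comm b w] at hab hbw hbu ⊢
  rw [mul_comm t u] at hbu
  field_simp
  ring

theorem stmt_2 (i j : ℤ) :
    Matrix.det (Matrix.of (Aent q2 t2 u2₁ u2₂ ![q2 ^ i * u2₁, q2 ^ j * u2₂])) /
        (q2 ^ i * u2₁ - q2 ^ j * u2₂) =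
      (t2 - 1) ^ 2 / ((t2 - q2 ^ i) * (t2 - q2 ^ j)) *
        (((1 - q2 ^ (2 * i) * u2₁) / (1 - q2 ^ i * u2₁)) *
            ((1 - q2 ^ (2 * j) * u2₂) / (1 - q2 ^ j * u2₂)) *
            (1 + t2⁻¹ * ((1 - q2 ^ i) / (1 - q2 ^ i * u2₁ / (t2 * u2₂))) *
              ((1 - q2 ^ j) / (1 - q2 ^ j * u2₂ / (t2 * u2₁))))
          - (q2 ^ i * u2₁ + q2 ^ j * u2₂) *
              ((1 - q2 ^ i) / (1 - q2 ^ i * u2₁)) *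
              ((1 - q2 ^ j) / (1 - q2 ^ j * u2₂)) *
              ((1 - q2 ^ i / t2) / (1 - q2 ^ i * u2₁ / (t2 * u2₂))) *
              ((1 - q2 ^ j / t2) / (1 - q2 ^ j * u2₂ / (t2 * u2₁)))) := by
  have inj := IsFractionRing.injective (MvPolynomial (Fin 4) ℚ) K2
  have X_ne (k : Fin 4) : algebraMap (MvPolynomial (Fin 4) ℚ) K2 (MvPolynomial.X k) ≠ 0 :=
    (map_ne_zero_iff _ inj).2 (MvPolynomial.X_ne_zero k)
  have hq : q2 ≠ 0 := X_ne 0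
  have hta (n : ℤ) : t2 - q2 ^ n ≠ 0 := sub_ne_zero.2 <| Ne.symm <| by
    simpa [t2] using q2_zpow_mul_ne n 1 (.X 1) (by simp)
  rw [zpow_mul' q2 2 i, zpow_mul' q2 2 j, zpow_ofNat, zpow_ofNat]
  refine det_Aent_div_eq _ _ _ _ _ _ (X_ne 1) (X_ne 2) (X_ne 3) ?_ (hta i) (hta j) ?_ ?_ ?_ ?_
  · intro h
    refine q2_zpow_mul_ne (i - j) (.X 2) (.X 3) (by simp) ?_
    rw [zpow_sub₀ hq, div_mul_eq_mul_div, div_eq_iff (zpow_ne_zero _ hq), mul_comm _ (q2 ^ j)]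
    exact sub_eq_zero.1 h
  · refine sub_ne_zero.2 <| Ne.symm ?_
    simpa [u2₁] using q2_zpow_mul_ne i (.X 2) 1 (by simp)
  · refine sub_ne_zero.2 <| Ne.symm ?_
    simpa [u2₂] using q2_zpow_mul_ne j (.X 3) 1 (by simp)
  · refine sub_ne_zero.2 <| Ne.symm ?_
    simpa [u2₁, u2₂, t2] using q2_zpow_mul_ne i (.X 2) (.X 1 * .X 3) (by simp; norm_num)
  · refine sub_ne_zero.2 <| Ne.symm ?_
    simpa [u2₁, u2₂, t2] using q2_zpow_mul_ne j (.X 3) (.X 1 * .X 2) (by simp; norm_num)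
end

section
/- Let i, j, r ∈ ℕ. In the field ℚ(q, t, u_0, u_1, u_2) of rational functions, C_{(i,j)}(u_0, u_1, u_2; 1, r) = ∇_{ij}(u_0, u_1, u_2) · (tu_1/u_0;q)_i/(qu_1/u_0;q)_i · (tu_2/u_0;q)_j/(qu_2/u_0;q)_j. -/
open Finset

/-- The `q`-shifted factorial `(a;q)_m` for an integer index `m`. -/
noncomputable def qPoch {K : Type*} [Field K] (a q : K) (m : ℤ) : K :=
  if 0 ≤ m then ∏ j ∈ Finset.range m.toNat, (1 - a * q ^ j)
  else (∏ j ∈ Finset.range (-m).toNat, (1 - a * q ^ (-(j : ℤ) - 1)))⁻¹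

noncomputable abbrev K5 : Type := FractionRing (MvPolynomial (Fin 5) ℚ)

noncomputable def q5 : K5 := algebraMap (MvPolynomial (Fin 5) ℚ) K5 (MvPolynomial.X 0)
noncomputable def t5 : K5 := algebraMap (MvPolynomial (Fin 5) ℚ) K5 (MvPolynomial.X 1)
noncomputable def w0 : K5 := algebraMap (MvPolynomial (Fin 5) ℚ) K5 (MvPolynomial.X 2)
noncomputable def w1 : K5 := algebraMap (MvPolynomial (Fin 5) ℚ) K5 (MvPolynomial.X 3)
noncomputable def w2 : K5 := algebraMap (MvPolynomial (Fin 5) ℚ) K5 (MvPolynomial.X 4)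

/-- The coefficient `C_θ(u₀,u₁,u₂;k,r)` for `θ = (θ₁,θ₂) ∈ ℕ²`, `1 ≤ k ≤ 3`, `r ∈ ℕ`,
where `v₁ = q^{θ₁}u₁` and `v₂ = q^{θ₂}u₂`. -/
noncomputable def Cc (u₀ u₁ u₂ : K5) (k r θ₁ θ₂ : ℕ) : K5 :=
  let q := q5; let t := t5
  let uu : Fin 2 → K5 := ![u₁, u₂]
  let th : Fin 2 → ℕ := ![θ₁, θ₂]
  let v : Fin 2 → K5 := ![q ^ θ₁ * u₁, q ^ θ₂ * u₂]
  q ^ (θ₁ + θ₂) *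
    (qPoch (t ^ 2 * u₀) q (θ₁ + θ₂) / qPoch (q * t * u₀) q (θ₁ + θ₂)) *
    (∏ i : Fin 2, (qPoch (q / t) q (th i) / qPoch q q (th i)) *
      (qPoch (q * uu i) q (th i) / qPoch (q * t * uu i) q (th i))) *
    (qPoch (q * v 0 / (t * v 1)) q θ₂ / qPoch (q * v 0 / v 1) q θ₂) *
    (qPoch (t * u₁ / v 1) q θ₂ / qPoch (u₁ / v 1) q θ₂) *
    (∏ i ∈ Finset.univ.filter (fun i : Fin 2 => (i : ℕ) + 1 < k),
      (qPoch (uu i / (t * u₀)) q (th i) / qPoch (q * uu i / (t ^ 2 * u₀)) q (th i)) *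
        (qPoch (q * t * u₀ / uu i) q r / qPoch (t ^ 2 * u₀ / uu i) q r) *
        (qPoch (t * u₀ / uu i) q r / qPoch (q * u₀ / uu i) q r)) *
    (∏ i ∈ Finset.univ.filter (fun i : Fin 2 => k ≤ (i : ℕ) + 1),
      qPoch (t * uu i / u₀) q (th i) / qPoch (q * uu i / u₀) q (th i)) *
    (v 0 - v 1)⁻¹ *
    Matrix.det (Matrix.of fun a b : Fin 2 =>
      v a ^ (2 - ((b : ℕ) + 1)) *
        (1 - t ^ (b : ℕ) * ((1 - t * v a) / (1 - v a)) *
          ((v a - u₁) / (v a - t * u₁)) * ((v a - u₂) / (v a - t * u₂))))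

/-- The quantity `∇_{ij}(u₀,u₁,u₂)` for `(i,j) ∈ ℕ²`. -/
noncomputable def Nab (u₀ u₁ u₂ : K5) (i j : ℕ) : K5 :=
  let q := q5; let t := t5
  q ^ (i + j) * (qPoch (t ^ 2 * u₀) q (i + j) / qPoch (q * t * u₀) q (i + j)) *
    (qPoch t⁻¹ q i / qPoch q q i) * (qPoch u₁ q i / qPoch (q * t * u₁) q i) *
    (qPoch t⁻¹ q j / qPoch q q j) * (qPoch u₂ q j / qPoch (q * t * u₂) q j) *
    (qPoch (q ^ ((i : ℤ) - j + 1) * u₁ / (t * u₂)) q j /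
      qPoch (q ^ ((i : ℤ) - j + 1) * u₁ / u₂) q j) *
    (qPoch (t * q ^ (-(j : ℤ)) * u₁ / u₂) q j / qPoch (q ^ (-(j : ℤ)) * u₁ / u₂) q j) *
    (((1 - q ^ (2 * i) * u₁) / (1 - u₁)) * ((1 - q ^ (2 * j) * u₂) / (1 - u₂)) *
        (1 + t⁻¹ * ((1 - q ^ i) / (1 - q ^ i * u₁ / (t * u₂))) *
          ((1 - q ^ j) / (1 - q ^ j * u₂ / (t * u₁))))
      - (q ^ i * u₁ + q ^ j * u₂) * ((1 - q ^ i) / (1 - u₁)) * ((1 - q ^ j) / (1 - u₂)) *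
          ((1 - q ^ i / t) / (1 - q ^ i * u₁ / (t * u₂))) *
          ((1 - q ^ j / t) / (1 - q ^ j * u₂ / (t * u₁))))

theorem qPoch_natCast {K : Type*} [Field K] (a q : K) (n : ℕ) :
    qPoch a q n = ∏ j ∈ Finset.range n, (1 - a * q ^ j) := by
  simp [qPoch]

theorem qPoch_mul_shift {K : Type*} [Field K] (a q : K) (n : ℕ) :
    qPoch (q * a) q n * (1 - a) = qPoch a q n * (1 - q ^ n * a) := by
  have h := Finset.prod_range_succ' (fun j => 1 - a * q ^ j) n
  rw [Finset.prod_range_succ] at h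
  rw [qPoch_natCast, qPoch_natCast, mul_comm (q ^ n), h]
  simp [pow_succ', mul_comm, mul_assoc]

theorem qPoch_shift {K : Type*} [Field K] (a q : K) (n : ℕ) (ha : 1 - a ≠ 0) :
    qPoch (q * a) q n = qPoch a q n * ((1 - q ^ n * a) / (1 - a)) := by
  rw [← mul_div_assoc, eq_div_iff ha, qPoch_mul_shift]

/-- Expansion of the two by two determinant, where `a` and `b` stand for `q ^ i` and `q ^ j`. -/
theorem det_expansion {K : Type*} [Field K] (a b t x y : K) (ht : t ≠ 0) (hx : x ≠ 0) (hy : y ≠ 0)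
    (ht1 : t - 1 ≠ 0) (hx1 : 1 - x ≠ 0) (hy1 : 1 - y ≠ 0) (hax : 1 - a * x ≠ 0)
    (hby : 1 - b * y ≠ 0) (hat : a - t ≠ 0) (hbt : b - t ≠ 0) (haty : a * x - t * y ≠ 0)
    (hbtx : b * y - t * x ≠ 0) (hab : a * x - b * y ≠ 0) :
    ((1 - a * t⁻¹) / (1 - t⁻¹)) * ((1 - b * t⁻¹) / (1 - t⁻¹)) *
      ((1 - a * x) / (1 - x)) * ((1 - b * y) / (1 - y)) * ((a * x - b * y)⁻¹ *
      (a * x * (1 - ((1 - t * (a * x)) / (1 - a * x)) *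
          ((a * x - x) / (a * x - t * x)) * ((a * x - y) / (a * x - t * y))) *
        (1 - t * ((1 - t * (b * y)) / (1 - b * y)) *
          ((b * y - x) / (b * y - t * x)) * ((b * y - y) / (b * y - t * y))) -
       (1 - t * ((1 - t * (a * x)) / (1 - a * x)) *
          ((a * x - x) / (a * x - t * x)) * ((a * x - y) / (a * x - t * y))) *
        (b * y * (1 - ((1 - t * (b * y)) / (1 - b * y)) *
          ((b * y - x) / (b * y - t * x)) * ((b * y - y) / (b * y - t * y)))))) =
    ((1 - a ^ 2 * x) / (1 - x)) * ((1 - b ^ 2 * y) / (1 - y)) *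
        (1 + t⁻¹ * ((1 - a) / (1 - a * x / (t * y))) * ((1 - b) / (1 - b * y / (t * x))))
      - (a * x + b * y) * ((1 - a) / (1 - x)) * ((1 - b) / (1 - y)) *
          ((1 - a / t) / (1 - a * x / (t * y))) * ((1 - b / t) / (1 - b * y / (t * x))) := by
  have e1 : 1 - a * x / (t * y) = -(a * x - t * y) / (t * y) := by field_simp; ring
  have e2 : 1 - b * y / (t * x) = -(b * y - t * x) / (t * x) := by field_simp; ring
  have e3 : 1 - a * t⁻¹ = -(a - t) / t := by field_simp; ring
  have e4 : 1 - b * t⁻¹ = -(b - t) / t := by field_simp; ring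
  have e5 : 1 - t⁻¹ = (t - 1) / t := by field_simp
  have e6 : (a * x - x) / (a * x - t * x) = (a - 1) / (a - t) := by
    rw [← sub_mul, ← mul_div_mul_right (a - 1) (a - t) hx, sub_mul a 1, one_mul]
  have e7 : (b * y - y) / (b * y - t * y) = (b - 1) / (b - t) := by
    rw [← sub_mul, ← mul_div_mul_right (b - 1) (b - t) hy, sub_mul b 1, one_mul]
  rw [e1, e2, e3, e4, e5, e6, e7]
  field_simp
  ring

theorem algebraMap_ne_of_eval_ne {σ : Type*} (x : σ → ℚ) {p r : MvPolynomial σ ℚ}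
    (h : MvPolynomial.eval x p ≠ MvPolynomial.eval x r) :
    algebraMap (MvPolynomial σ ℚ) (FractionRing (MvPolynomial σ ℚ)) p ≠ algebraMap _ _ r :=
  fun e => h (congrArg _ (IsFractionRing.injective _ _ e))

theorem stmt_3 (i j r : ℕ) :
    Cc w0 w1 w2 1 r i j =
      Nab w0 w1 w2 i j *
        (qPoch (t5 * w1 / w0) q5 i / qPoch (q5 * w1 / w0) q5 i) *
        (qPoch (t5 * w2 / w0) q5 j / qPoch (q5 * w2 / w0) q5 j) := by
  have key (p s : MvPolynomial (Fin 5) ℚ)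
      (h : MvPolynomial.eval ![1, 5, 1, 2, 3] p ≠ MvPolynomial.eval ![1, 5, 1, 2, 3] s) :
      algebraMap _ K5 p - algebraMap _ K5 s ≠ 0 :=
    sub_ne_zero.2 (algebraMap_ne_of_eval_ne _ h)
  have hq : q5 ≠ 0 := by simp [q5]
  have ht : t5 ≠ 0 := by simp [t5]
  have hx : w1 ≠ 0 := by simp [w1]
  have hy : w2 ≠ 0 := by simp [w2]
  have ht1 : t5 - 1 ≠ 0 := by simpa [t5] using key (.X 1) 1 (by simp)
  have hx1 : 1 - w1 ≠ 0 := by simpa [w1] using key 1 (.X 3) (by simp)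
  have hy1 : 1 - w2 ≠ 0 := by simpa [w2] using key 1 (.X 4) (by simp)
  have hax : 1 - q5 ^ i * w1 ≠ 0 := by
    simpa [q5, w1] using key 1 (.X 0 ^ i * .X 3) (by simp)
  have hby : 1 - q5 ^ j * w2 ≠ 0 := by
    simpa [q5, w2] using key 1 (.X 0 ^ j * .X 4) (by simp)
  have hat : q5 ^ i - t5 ≠ 0 := by
    simpa [q5, t5] using key (.X 0 ^ i) (.X 1) (by simp)
  have hbt : q5 ^ j - t5 ≠ 0 := by
    simpa [q5, t5] using key (.X 0 ^ j) (.X 1) (by simp)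
  have haty : q5 ^ i * w1 - t5 * w2 ≠ 0 := by
    simpa [q5, t5, w1, w2] using key (.X 0 ^ i * .X 3) (.X 1 * .X 4) (by simp; norm_num)
  have hbtx : q5 ^ j * w2 - t5 * w1 ≠ 0 := by
    simpa [q5, t5, w1, w2] using key (.X 0 ^ j * .X 4) (.X 1 * .X 3) (by simp; norm_num)
  have hab : q5 ^ i * w1 - q5 ^ j * w2 ≠ 0 := by
    simpa [q5, w1, w2] using key (.X 0 ^ i * .X 3) (.X 0 ^ j * .X 4) (by simp)
  have hti : 1 - t5⁻¹ ≠ 0 := by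
    rw [sub_ne_zero, ne_comm, Ne, inv_eq_one]; exact sub_ne_zero.1 ht1
  have hz : q5 ^ ((i : ℤ) - j + 1) = q5 * q5 ^ i / q5 ^ j := by
    rw [zpow_add_one₀ hq, zpow_sub₀ hq]; simp; ring
  have p1 : q5 * (q5 ^ i * w1) / (t5 * (q5 ^ j * w2)) =
      q5 ^ ((i : ℤ) - j + 1) * w1 / (t5 * w2) := by rw [hz]; field_simp
  have p2 : q5 * (q5 ^ i * w1) / (q5 ^ j * w2) = q5 ^ ((i : ℤ) - j + 1) * w1 / w2 := by
    rw [hz]; field_simp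
  have p3 : t5 * w1 / (q5 ^ j * w2) = t5 * q5 ^ (-(j : ℤ)) * w1 / w2 := by
    rw [zpow_neg, zpow_natCast]; field_simp
  have p4 : w1 / (q5 ^ j * w2) = q5 ^ (-(j : ℤ)) * w1 / w2 := by
    rw [zpow_neg, zpow_natCast]; field_simp
  have D := det_expansion (q5 ^ i) (q5 ^ j) t5 w1 w2 ht hx hy ht1 hx1 hy1 hax hby hat hbt haty
    hbtx hab
  rw [← pow_mul', ← pow_mul'] at D
  have f1 : Finset.univ.filter (fun i : Fin 2 => (i : ℕ) + 1 < 1) = ∅ := by decide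
  have f2 : Finset.univ.filter (fun i : Fin 2 => 1 ≤ (i : ℕ) + 1) = Finset.univ := by decide
  simp only [Cc, Nab, f1, f2, Finset.prod_empty, Fin.prod_univ_two, Matrix.det_fin_two,
    Matrix.of_apply, Matrix.cons_val_zero, Matrix.cons_val_one, Fin.val_zero, Fin.val_one,
    p1, p2, p3, p4, ← D, div_eq_mul_inv q5 t5, qPoch_shift t5⁻¹ q5 _ hti,
    qPoch_shift w1 q5 _ hx1, qPoch_shift w2 q5 _ hy1]
  simp only [pow_zero, pow_one, zero_add, Nat.sub_self, Nat.add_one_sub_one, one_mul, Nat.reduceAdd]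
  generalize (q5 ^ i * w1 - q5 ^ j * w2)⁻¹ = d
  ring
end

section
/- Let i, j, r ∈ ℕ. In the field ℚ(q, t, u_0, u_1, u_2) of rational functions, C_{(i,j)}(u_0, u_1, u_2; 3, r) = ∇_{ij}(u_0, u_1, u_2) · (u_1/tu_0;q)_i/(qu_1/t²u_0;q)_i · (qtu_0/u_1;q)_r/(t²u_0/u_1;q)_r · (tu_0/u_1;q)_r/(qu_0/u_1;q)_r · (u_2/tu_0;q)_j/(qu_2/t²u_0;q)_j · (qtu_0/u_2;q)_r/(t²u_0/u_2;q)_r · (tu_0/u_2;q)_r/(qu_0/u_2;q)_r. -/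
open Finset

/-- The shift relation `(qa;q)_n = (a;q)_n (1 - a q^n) / (1 - a)`. -/
theorem qPoch_mul_left {K : Type*} [Field K] {a : K} (q : K) (ha : 1 - a ≠ 0) (n : ℕ) :
    qPoch (q * a) q n = qPoch a q n * ((1 - q ^ n * a) / (1 - a)) := by
  have h : ∀ b : K, qPoch b q n = ∏ j ∈ Finset.range n, (1 - b * q ^ j) := fun b ↦ by
    simp [qPoch]
  rw [h, h, ← mul_div_assoc, eq_div_iff ha]
  have h₁ := Finset.prod_range_succ (fun j ↦ 1 - a * q ^ j) n
  have h₂ := Finset.prod_range_succ' (fun j ↦ 1 - a * q ^ j) n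
  rw [pow_zero, mul_one] at h₂
  rw [mul_comm (q ^ n) a, ← h₁, h₂]
  congr 1
  exact Finset.prod_congr rfl fun j _ ↦ by ring

/-- An element of `ℚ(q, t, u₀, u₁, u₂)` represented by a polynomial not vanishing at the point
`(1, 5, 1, 2, 3)` is nonzero. -/
theorem algebraMap_ne_zero_of_eval_ne_zero (p : MvPolynomial (Fin 5) ℚ)
    (hp : MvPolynomial.eval ![1, 5, 1, 2, 3] p ≠ 0) :
    algebraMap (MvPolynomial (Fin 5) ℚ) K5 p ≠ 0 := by
  rw [Ne, IsFractionRing.to_map_eq_zero_iff]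
  rintro rfl
  exact hp (map_zero _)

/-- The rational function identity relating the determinant in `Cc` to the bracket in `Nab`, where
`A` and `B` stand for `q ^ i` and `q ^ j`. -/
theorem det_eq_bracket {K : Type*} [Field K] {A B t u v : K} (ht : t ≠ 0) (hu : u ≠ 0)
    (hv : v ≠ 0) (ht₁ : t - 1 ≠ 0) (hu₁ : 1 - u ≠ 0) (hv₁ : 1 - v ≠ 0) (hA : 1 - A * u ≠ 0)
    (hB : 1 - B * v ≠ 0) (hAB : A * u - B * v ≠ 0) (hAt : A - t ≠ 0) (hBt : B - t ≠ 0)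
    (hAv : A * u - t * v ≠ 0) (hBu : B * v - t * u ≠ 0) :
    ((1 - A * t⁻¹) / (1 - t⁻¹)) * ((1 - A * u) / (1 - u)) *
      (((1 - B * t⁻¹) / (1 - t⁻¹)) * ((1 - B * v) / (1 - v))) * (A * u - B * v)⁻¹ *
      (A * u * (1 - (1 - t * (A * u)) / (1 - A * u) *
            ((A * u - u) / (A * u - t * u)) * ((A * u - v) / (A * u - t * v))) *
          (1 - t * ((1 - t * (B * v)) / (1 - B * v)) *
            ((B * v - u) / (B * v - t * u)) * ((B * v - v) / (B * v - t * v))) -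
        (1 - t * ((1 - t * (A * u)) / (1 - A * u)) *
            ((A * u - u) / (A * u - t * u)) * ((A * u - v) / (A * u - t * v))) *
          (B * v * (1 - (1 - t * (B * v)) / (1 - B * v) *
            ((B * v - u) / (B * v - t * u)) * ((B * v - v) / (B * v - t * v))))) =
    ((1 - A ^ 2 * u) / (1 - u)) * ((1 - B ^ 2 * v) / (1 - v)) *
        (1 + t⁻¹ * ((1 - A) / (1 - A * u / (t * v))) * ((1 - B) / (1 - B * v / (t * u))))
      - (A * u + B * v) * ((1 - A) / (1 - u)) * ((1 - B) / (1 - v)) *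
          ((1 - A / t) / (1 - A * u / (t * v))) * ((1 - B / t) / (1 - B * v / (t * u))) := by
  have e₁ : 1 - A * u / (t * v) = -(A * u - t * v) / (t * v) := by field_simp; ring
  have e₂ : 1 - B * v / (t * u) = -(B * v - t * u) / (t * u) := by field_simp; ring
  have e₃ : (A * u - u) / (A * u - t * u) = (A - 1) / (A - t) := by
    rw [← mul_div_mul_right (_ - 1) _ hu, sub_one_mul, sub_mul]
  have e₄ : (B * v - v) / (B * v - t * v) = (B - 1) / (B - t) := by
    rw [← mul_div_mul_right (_ - 1) _ hv, sub_one_mul, sub_mul]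
  have e₅ : (1 - A * t⁻¹) / (1 - t⁻¹) = -(A - t) / (t - 1) := by field_simp; ring
  have e₆ : (1 - B * t⁻¹) / (1 - t⁻¹) = -(B - t) / (t - 1) := by field_simp; ring
  rw [e₁, e₂, e₃, e₄, e₅, e₆]
  field_simp
  ring

theorem stmt_5 (i j r : ℕ) :
    Cc w0 w1 w2 3 r i j =
      Nab w0 w1 w2 i j *
        (qPoch (w1 / (t5 * w0)) q5 i / qPoch (q5 * w1 / (t5 ^ 2 * w0)) q5 i) *
        (qPoch (q5 * t5 * w0 / w1) q5 r / qPoch (t5 ^ 2 * w0 / w1) q5 r) *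
        (qPoch (t5 * w0 / w1) q5 r / qPoch (q5 * w0 / w1) q5 r) *
        (qPoch (w2 / (t5 * w0)) q5 j / qPoch (q5 * w2 / (t5 ^ 2 * w0)) q5 j) *
        (qPoch (q5 * t5 * w0 / w2) q5 r / qPoch (t5 ^ 2 * w0 / w2) q5 r) *
        (qPoch (t5 * w0 / w2) q5 r / qPoch (q5 * w0 / w2) q5 r) := by
  have ht : t5 ≠ 0 := algebraMap_ne_zero_of_eval_ne_zero _ (by simp)
  have hu : w1 ≠ 0 := algebraMap_ne_zero_of_eval_ne_zero _ (by simp)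
  have hv : w2 ≠ 0 := algebraMap_ne_zero_of_eval_ne_zero _ (by simp)
  have ht₁ : t5 - 1 ≠ 0 := by
    simpa [t5] using algebraMap_ne_zero_of_eval_ne_zero (.X 1 - 1) (by simp; norm_num)
  have hu₁ : 1 - w1 ≠ 0 := by
    simpa [w1] using algebraMap_ne_zero_of_eval_ne_zero (1 - .X 3) (by simp; norm_num)
  have hv₁ : 1 - w2 ≠ 0 := by
    simpa [w2] using algebraMap_ne_zero_of_eval_ne_zero (1 - .X 4) (by simp; norm_num)
  have hA : 1 - q5 ^ i * w1 ≠ 0 := by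
    simpa [q5, w1] using
      algebraMap_ne_zero_of_eval_ne_zero (1 - .X 0 ^ i * .X 3) (by simp; norm_num)
  have hB : 1 - q5 ^ j * w2 ≠ 0 := by
    simpa [q5, w2] using
      algebraMap_ne_zero_of_eval_ne_zero (1 - .X 0 ^ j * .X 4) (by simp; norm_num)
  have hAB : q5 ^ i * w1 - q5 ^ j * w2 ≠ 0 := by
    simpa [q5, w1, w2] using
      algebraMap_ne_zero_of_eval_ne_zero (.X 0 ^ i * .X 3 - .X 0 ^ j * .X 4) (by simp; norm_num)
  have hAt : q5 ^ i - t5 ≠ 0 := by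
    simpa [q5, t5] using algebraMap_ne_zero_of_eval_ne_zero (.X 0 ^ i - .X 1) (by simp; norm_num)
  have hBt : q5 ^ j - t5 ≠ 0 := by
    simpa [q5, t5] using algebraMap_ne_zero_of_eval_ne_zero (.X 0 ^ j - .X 1) (by simp; norm_num)
  have hAv : q5 ^ i * w1 - t5 * w2 ≠ 0 := by
    simpa [q5, t5, w1, w2] using
      algebraMap_ne_zero_of_eval_ne_zero (.X 0 ^ i * .X 3 - .X 1 * .X 4) (by simp; norm_num)
  have hBu : q5 ^ j * w2 - t5 * w1 ≠ 0 := by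
    simpa [q5, t5, w1, w2] using
      algebraMap_ne_zero_of_eval_ne_zero (.X 0 ^ j * .X 4 - .X 1 * .X 3) (by simp; norm_num)
  have hq : q5 ≠ 0 := algebraMap_ne_zero_of_eval_ne_zero _ (by simp)
  have ht' : 1 - t5⁻¹ ≠ 0 := by
    rw [← inv_mul_cancel₀ ht, ← mul_sub_one]
    exact mul_ne_zero (inv_ne_zero ht) ht₁
  have key := det_eq_bracket ht hu hv ht₁ hu₁ hv₁ hA hB hAB hAt hBt hAv hBu
  have a₁ : q5 ^ ((i : ℤ) - j + 1) * w1 / (t5 * w2) =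
      q5 * (q5 ^ i * w1) / (t5 * (q5 ^ j * w2)) := by
    rw [zpow_add₀ hq, zpow_sub₀ hq, zpow_natCast, zpow_natCast, zpow_one]; field_simp
  have a₂ : q5 ^ ((i : ℤ) - j + 1) * w1 / w2 = q5 * (q5 ^ i * w1) / (q5 ^ j * w2) := by
    rw [zpow_add₀ hq, zpow_sub₀ hq, zpow_natCast, zpow_natCast, zpow_one]; field_simp
  have a₃ : t5 * q5 ^ (-(j : ℤ)) * w1 / w2 = t5 * w1 / (q5 ^ j * w2) := by
    rw [zpow_neg, zpow_natCast]; field_simp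
  have a₄ : q5 ^ (-(j : ℤ)) * w1 / w2 = w1 / (q5 ^ j * w2) := by
    rw [zpow_neg, zpow_natCast]; field_simp
  have hfilter : Finset.univ.filter (fun a : Fin 2 ↦ (a : ℕ) + 1 < 3) = Finset.univ := by decide
  have hfilter' : Finset.univ.filter (fun a : Fin 2 ↦ 3 ≤ (a : ℕ) + 1) = ∅ := by decide
  simp only [Cc, Nab]
  rw [a₁, a₂, a₃, a₄, mul_comm 2 i, mul_comm 2 j, pow_mul q5 i, pow_mul q5 j, ← key, hfilter,
    hfilter']
  simp only [Matrix.det_fin_two, Fin.prod_univ_two, Finset.prod_empty, Matrix.of_apply,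
    Matrix.cons_val_zero, Matrix.cons_val_one, Fin.val_zero, Fin.val_one, pow_zero, pow_one,
    zero_add, one_mul, mul_one, Nat.reduceAdd, Nat.reduceSub, div_eq_mul_inv q5 t5,
    qPoch_mul_left q5 ht', qPoch_mul_left q5 hu₁, qPoch_mul_left q5 hv₁]
  ring
end

section
/- Let n ≥ 1, r ∈ ℕ, let μ_1 ≥ μ_2 ≥ ⋯ ≥ μ_{n+1} ≥ 0 be integers, and let θ = (θ_1, …, θ_{n+1}) ∈ ℕ^{n+1} with |θ| = r. In the field ℚ(q, t), set u_i = q^{μ_i} t^{-i} and v_i = q^{θ_i} u_i for 1 ≤ i ≤ n+1. If there exists an index i with 1 ≤ i ≤ n and μ_i + θ_i < μ_{i+1} + θ_{i+1}, then d_θ(u_1, …, u_{n+1}; r) = 0. -/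
open Finset

noncomputable abbrev KQT : Type := FractionRing (MvPolynomial (Fin 2) ℚ)

noncomputable def qq : KQT := algebraMap (MvPolynomial (Fin 2) ℚ) KQT (MvPolynomial.X 0)
noncomputable def tt : KQT := algebraMap (MvPolynomial (Fin 2) ℚ) KQT (MvPolynomial.X 1)

/-- The Pieri coefficient `d_θ(u₁,…,u_{n+1};r)`, where `v_i = q^{θ_i} u_i`.
Indices `0,…,n` of `Fin (n+1)` represent the indices `1,…,n+1`. -/
noncomputable def dCoef {n : ℕ} (u : Fin (n + 1) → KQT) (θ : Fin (n + 1) → ℕ) (r : ℕ) :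
    KQT :=
  let v : Fin (n + 1) → KQT := fun i => qq ^ θ i * u i
  (qPoch qq qq r / qPoch tt qq r) *
    (∏ j, qPoch tt qq (θ j) / qPoch qq qq (θ j)) *
    ∏ i, ∏ j ∈ Finset.Ioi i,
      (qPoch (tt * v i / v j) qq (θ j) / qPoch (qq * v i / v j) qq (θ j)) *
        (qPoch (qq * u i / (tt * v j)) qq (θ j) / qPoch (u i / v j) qq (θ j))

theorem qq_ne_zero : qq ≠ 0 := by
  simp [qq, MvPolynomial.X_ne_zero]

theorem tt_ne_zero : tt ≠ 0 := by
  simp [tt, MvPolynomial.X_ne_zero]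

theorem qPoch_eq_zero {K : Type*} [Field K] {a q : K} {m k : ℕ} (hk : k < m)
    (h : a * q ^ k = 1) : qPoch a q m = 0 := by
  simp only [qPoch, Int.natCast_nonneg, if_true, Int.toNat_natCast]
  exact prod_eq_zero (mem_range.mpr hk) (by rw [h, sub_self])

theorem stmt_8 (n : ℕ) (hn : 1 ≤ n) (r : ℕ) (μ : Fin (n + 1) → ℤ)
    (hμ : Antitone μ) (hμ0 : ∀ i, 0 ≤ μ i)
    (θ : Fin (n + 1) → ℕ) (hθ : ∑ i, θ i = r)
    (hbad : ∃ i : Fin n, μ i.castSucc + θ i.castSucc < μ i.succ + θ i.succ) :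
    dCoef (fun i => qq ^ μ i * tt ^ (-((i : ℕ) + 1 : ℤ))) θ r = 0 := by
  obtain ⟨i, hi⟩ := hbad
  have hle : μ i.succ ≤ μ i.castSucc := hμ i.castSucc_lt_succ.le
  obtain ⟨k, hk⟩ : ∃ k : ℕ, (k : ℤ) = μ i.succ + θ i.succ - μ i.castSucc - 1 :=
    ⟨_, Int.toNat_of_nonneg (by omega)⟩
  unfold dCoef
  refine mul_eq_zero_of_right _ (prod_eq_zero (mem_univ i.castSucc)
    (prod_eq_zero (mem_Ioi.mpr i.castSucc_lt_succ) (mul_eq_zero_of_right _ ?_)))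
  rw [qPoch_eq_zero (k := k) (by omega), zero_div]
  have hq := qq_ne_zero
  have ht := tt_ne_zero
  have hqpow : qq * qq ^ μ i.castSucc * qq ^ k = qq ^ θ i.succ * qq ^ μ i.succ := by
    simp only [← zpow_natCast, ← zpow_one_add₀ hq, ← zpow_add₀ hq]
    congr 1
    omega
  have htpow : tt * tt ^ (-((i.succ : ℕ) + 1 : ℤ)) = tt ^ (-((i.castSucc : ℕ) + 1 : ℤ)) := by
    rw [← zpow_one_add₀ ht]
    congr 1
  rw [div_mul_eq_mul_div, div_eq_one_iff_eq
    (mul_ne_zero ht (mul_ne_zero (pow_ne_zero _ hq)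
      (mul_ne_zero (zpow_ne_zero _ hq) (zpow_ne_zero _ ht))))]
  beta_reduce
  rw [← htpow]
  linear_combination tt * tt ^ (-((i.succ : ℕ) + 1 : ℤ)) * hqpow
end

section
/- Let n ≥ 1 and r ∈ ℕ. In ℝ^{n+1}, let O be the set of all vectors obtained from (r, 0, …, 0) by permuting the coordinates (the orbit of r·e_1 under the symmetric group S_{n+1} acting by coordinate permutations). Then the intersection of the convex hull of O with the integer lattice ℤ^{n+1} equals { θ ∈ ℤ^{n+1} : θ_i ≥ 0 for all i and θ_1 + ⋯ + θ_{n+1} = r }. -/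
open Finset

/-- The convex hull of the vectors `c • eᵢ` is the standard simplex dilated by `c ≥ 0`. -/
theorem convexHull_range_single {ι : Type*} [Fintype ι] [DecidableEq ι] [Nonempty ι]
    {c : ℝ} (hc : 0 ≤ c) :
    convexHull ℝ (Set.range fun i : ι => (Pi.single i c : ι → ℝ)) =
      {v | (∀ i, 0 ≤ v i) ∧ ∑ i, v i = c} := by
  apply Set.Subset.antisymm
  · refine convexHull_min ?_ ?_
    · rintro _ ⟨i, rfl⟩
      refine ⟨fun j => ?_, by simp⟩
      simp only [Pi.single_apply]
      split_ifs <;> simp [hc]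
    · rintro v ⟨hv, hvs⟩ w ⟨hw, hws⟩ a b ha hb hab
      refine ⟨fun i => add_nonneg (mul_nonneg ha (hv i)) (mul_nonneg hb (hw i)), ?_⟩
      simp only [Pi.add_apply, Pi.smul_apply, smul_eq_mul, Finset.sum_add_distrib,
        ← Finset.mul_sum, hvs, hws]
      rw [← add_mul, hab, one_mul]
  · rintro v ⟨hv, hvs⟩
    rcases hc.eq_or_lt with rfl | hpos
    · have hv0 : v = 0 := by
        funext i
        exact (Finset.sum_eq_zero_iff_of_nonneg fun i _ => hv i).1 hvs i (Finset.mem_univ i)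
      exact subset_convexHull ℝ _ ⟨Classical.arbitrary ι, by simp [hv0]⟩
    · have hsum : ∑ i, (v i / c) • (Pi.single i c : ι → ℝ) = v := by
        funext j
        simp [Finset.sum_apply, Pi.single_apply, hpos.ne']
      rw [← hsum]
      refine (convex_convexHull ℝ _).sum_mem (fun i _ => div_nonneg (hv i) hc) ?_
        fun i _ => subset_convexHull ℝ _ ⟨i, rfl⟩
      rw [← Finset.sum_div, hvs, div_self hpos.ne']

theorem stmt_17 (n : ℕ) (hn : 1 ≤ n) (r : ℕ) :
    let x : Fin (n + 1) → ℝ := fun i => if i = 0 then (r : ℝ) else 0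
    let O : Set (Fin (n + 1) → ℝ) := {v | ∃ σ : Equiv.Perm (Fin (n + 1)), v = x ∘ σ}
    (convexHull ℝ O) ∩ {v : Fin (n + 1) → ℝ | ∀ i, ∃ m : ℤ, v i = (m : ℝ)} =
      {v : Fin (n + 1) → ℝ |
        (∀ i, ∃ m : ℤ, v i = (m : ℝ)) ∧ (∀ i, 0 ≤ v i) ∧ ∑ i, v i = (r : ℝ)} := by
  intro x O
  have hO : O = Set.range fun i : Fin (n + 1) => (Pi.single i (r : ℝ) : Fin (n + 1) → ℝ) := by
    ext v
    constructor
    · rintro ⟨σ, rfl⟩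
      refine ⟨σ.symm 0, ?_⟩
      funext j
      simp [x, Pi.single_apply, Equiv.eq_symm_apply]
    · rintro ⟨i, rfl⟩
      refine ⟨Equiv.swap i 0, ?_⟩
      funext j
      have h : Equiv.swap i 0 j = 0 ↔ j = i := by
        rw [Equiv.swap_apply_eq_iff, Equiv.swap_apply_right]
      simp [x, Pi.single_apply, h]
  rw [hO, convexHull_range_single r.cast_nonneg, Set.inter_comm]
  rfl
end
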